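/- Let α ∈ Σ₂¹ ∖ P and β ∈ Σ₂⁰ ∖ P̄ be such that σⁿ(β) ≺ α and σⁿ(α) ≻ β for every n ≥ 1. Then Σ_{(α,β)} = Σ_{(ς(α), ς'(β))}. -/

import Mathlib

open Filter MeasureTheory

namespace DoublingHole

/-- One-sided binary sequences (indexed from 0, corresponding to x₁x₂x₃⋯). -/
abbrev Seq : Type := ℕ → Bool

/-- The one-sided shift map σ. -/
def shift (x : Seq) : Seq := fun n => x (n + 1)

/-- Strict lexicographic order ≺ on sequences. -/
def lexLt (x y : Seq) : Prop := ∃ k : ℕ, (∀ i, i < k → x i = y i) ∧ x k < y k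

/-- Reflexive lexicographic order ≼ on sequences. -/
def lexLe (x y : Seq) : Prop := lexLt x y ∨ x = y

/-- The lexicographic subshift Σ_{(α,β)} = {x : β ≼ σⁿx ≼ α for all n ≥ 0}. -/
def lexSubshift (α β : Seq) : Set Seq :=
  {x | ∀ n : ℕ, lexLe β (shift^[n] x) ∧ lexLe (shift^[n] x) α}

/-- The projection π : Σ₂ → [0,1], π(x) = Σ xᵢ 2^{-i}. -/
noncomputable def piMap (x : Seq) : ℝ := ∑' i : ℕ, if x i then (1 : ℝ) / 2 ^ (i + 1) else 0

/-- The mirror image x̄ of a sequence. -/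
def mirror (x : Seq) : Seq := fun n => !(x n)

/-- The set P of Parry sequences: α₁ = 1 and σⁿα ≼ α for all n ≥ 1. -/
def ParryP : Set Seq := {α | α 0 = true ∧ ∀ n, 1 ≤ n → lexLe (shift^[n] α) α}

/-- The set P̄ of mirror images of Parry sequences. -/
def barP : Set Seq := {β | mirror β ∈ ParryP}

/-- Periodic sequences. -/
def PerSet : Set Seq := {x | ∃ k, 1 ≤ k ∧ shift^[k] x = x}

/-- Membership in the lexicographic world LW. -/
def inLW (α β : Seq) : Prop :=
  α ∈ ParryP ∧ β ∈ barP ∧ ∀ n, 1 ≤ n → lexLe β (shift^[n] α) ∧ lexLe (shift^[n] β) α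

/-- The doubling map x ↦ 2x (mod 1) on S¹ identified with [0,1). -/
noncomputable def dbl (x : ℝ) : ℝ := Int.fract (2 * x)

/-- The exceptional set X_{(a,b)} of points whose orbit avoids the hole (a,b). -/
def Xset (a b : ℝ) : Set ℝ :=
  {x | x ∈ Set.Ico (0 : ℝ) 1 ∧ ∀ n : ℕ, dbl^[n] x ∉ Set.Ioo a b}

/-- The attractor Λ_{(a,b)} = [2b-1, 2a] ∩ X_{(a,b)}. -/
def Lam (a b : ℝ) : Set ℝ := Set.Icc (2 * b - 1) (2 * a) ∩ Xset a b

/-- χ(a) = sup{b : X_{(a,b)} is uncountable}. -/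
noncomputable def chiFn (a : ℝ) : ℝ :=
  sSup {b | b ∈ Set.Ico (0 : ℝ) 1 ∧ ¬ (Xset a b).Countable}

/-- The parameter region D₁. -/
def D1 : Set (ℝ × ℝ) :=
  {p | p.1 ∈ Set.Ioo (1/4 : ℝ) (1/2) ∧ p.2 ∈ Set.Ioo (1/2 : ℝ) (3/4) ∧ p.2 ≤ chiFn p.1}

/-- The set S of parameters whose endpoints both fall into the hole. -/
def Sset : Set (ℝ × ℝ) :=
  {p | p ∈ D1 ∧ (∃ n, 1 ≤ n ∧ dbl^[n] p.1 ∈ Set.Ioo p.1 p.2) ∧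
        ∃ m, 1 ≤ m ∧ dbl^[m] p.2 ∈ Set.Ioo p.1 p.2}

/-- The finite word w occurs in (is a factor of) the sequence x. -/
def occursIn (w : List Bool) (x : Seq) : Prop :=
  ∃ i : ℕ, w = List.ofFn fun j : Fin w.length => x (i + (j : ℕ))

/-- The language of a subshift: all finite factors of its elements. -/
def Lang (A : Set Seq) : Set (List Bool) := {w | ∃ x ∈ A, occursIn w x}

/-- A set of sequences is a subshift of finite type if it is defined by
finitely many forbidden words. -/
def IsSFT (A : Set Seq) : Prop :=
  ∃ F : Finset (List Bool), A = {x | ∀ w ∈ F, ¬ occursIn w x}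

/-- B_n(A): the admissible words of length n. -/
def wordsOfLen (A : Set Seq) (n : ℕ) : Set (List Bool) :=
  {w | w.length = n ∧ w ∈ Lang A}

/-- Topological transitivity of a subshift, phrased via its language. -/
def TransitiveShift (A : Set Seq) : Prop :=
  ∀ u ∈ Lang A, ∀ v ∈ Lang A, ∃ t ∈ Lang A, u ++ t ++ v ∈ Lang A

/-- Cyclic rotation of a finite word. -/
def rot (w : List Bool) (k : ℕ) : List Bool := w.drop k ++ w.take k

/-- Lexicographic (dictionary) order on finite words. -/
def listLe (u v : List Bool) : Prop := List.Lex (· < ·) u v ∨ u = v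

/-- w = 0-max_w : w starts with 0 and is the lexicographically largest
cyclic permutation of itself starting with 0. -/
def isZeroMax (w : List Bool) : Prop :=
  w.headD true = false ∧
    ∀ k, k < w.length → (rot w k).headD true = false → listLe (rot w k) w

/-- w = 1-min_w : w starts with 1 and is the lexicographically smallest
cyclic permutation of itself starting with 1. -/
def isOneMin (w : List Bool) : Prop :=
  w.headD false = true ∧
    ∀ k, k < w.length → (rot w k).headD false = true → listLe w (rot w k)

/-- v is the 0-max cyclic permutation of w. -/
def isZeroMaxOf (v w : List Bool) : Prop :=
  (∃ k, k < w.length ∧ v = rot w k) ∧ v.headD true = false ∧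
    ∀ k, k < w.length → (rot w k).headD true = false → listLe (rot w k) v

/-- u is the 1-min cyclic permutation of w. -/
def isOneMinOf (u w : List Bool) : Prop :=
  (∃ k, k < w.length ∧ u = rot w k) ∧ u.headD false = true ∧
    ∀ k, k < w.length → (rot w k).headD false = true → listLe u (rot w k)

/-- The periodic sequence w^∞. -/
def periodicSeq (w : List Bool) : Seq := fun i => w.getD (i % w.length) false

/-- The sequence w followed by x. -/
def wordThen (w : List Bool) (x : Seq) : Seq :=
  fun i => if i < w.length then w.getD i false else x (i - w.length)

/-- Prepend one symbol to a sequence (e.g. 0α, 1β). -/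
def consSeq (a : Bool) (x : Seq) : Seq := fun i => if i = 0 then a else x (i - 1)

/-- A word is balanced if any two factors of equal length have numbers of 1's
differing by at most one. -/
def balanced (w : List Bool) : Prop :=
  ∀ u v : List Bool, u <:+: w → v <:+: w → u.length = v.length →
    ((u.count true : ℤ) - (v.count true : ℤ)).natAbs ≤ 1

/-- A word is cyclically balanced if its square is balanced. -/
def cycBalanced (w : List Bool) : Prop := balanced (w ++ w)

/-- Infinite concatenation of a sequence of (nonempty) finite words. -/
noncomputable def concatSeq (b : ℕ → List Bool) : Seq := fun i =>
  (b (sInf {n : ℕ | i < ∑ k ∈ Finset.range (n + 1), (b k).length})).getD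
    (i - ∑ k ∈ Finset.range (sInf {n : ℕ | i < ∑ k ∈ Finset.range (n + 1), (b k).length}), (b k).length)
    false

/-- (α,β) is renormalisable by the finite words ω and ν:
ω = 0-max_ω, ν = 1-min_ν, (0-max_ν)^∞ ≺ ω^∞, ν^∞ ≺ (1-min_ω)^∞, ℓ(ων) ≥ 3, and
0α = ω ν^{n₁^ν} ω^{n₁^ω} ν^{n₂^ν} ⋯ and 1β = ν ω^{m₁^ω} ν^{m₁^ν} ⋯ with all
exponents in ℕ ∪ {∞}; equivalently 0α (resp. 1β) is an infinite concatenation of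
copies of ω and ν whose first two blocks are ω, ν (resp. ν, ω). -/
def RenormalisableBy (α β : Seq) (ω ν : List Bool) : Prop :=
  isZeroMax ω ∧ isOneMin ν ∧
  (∀ v, isZeroMaxOf v ν → lexLt (periodicSeq v) (periodicSeq ω)) ∧
  (∀ u, isOneMinOf u ω → lexLt (periodicSeq ν) (periodicSeq u)) ∧
  3 ≤ ω.length + ν.length ∧
  (∃ b : ℕ → List Bool, b 0 = ω ∧ b 1 = ν ∧ (∀ k, b k = ω ∨ b k = ν) ∧
    consSeq false α = concatSeq b) ∧
  (∃ c : ℕ → List Bool, c 0 = ν ∧ c 1 = ω ∧ (∀ k, c k = ω ∨ c k = ν) ∧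
    consSeq true β = concatSeq c)

/-- (α,β) is renormalisable by an infinite sequence: either 0α = ω and 1β = νω
with ω infinite and ν = 1-min_ν finite, or 0α = ων and 1β = ν with ν infinite
and ω = 0-max_ω finite. -/
def RenormInfBy (α β : Seq) : Prop :=
  (∃ ν : List Bool, isOneMin ν ∧ consSeq true β = wordThen ν (consSeq false α)) ∨
  (∃ ω : List Bool, isZeroMax ω ∧ consSeq false α = wordThen ω (consSeq true β))

/-- n_α = min{n ≥ 1 : σⁿα ≻ α}. -/
noncomputable def nAlpha (α : Seq) : ℕ := sInf {n | 1 ≤ n ∧ lexLt α (shift^[n] α)}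

/-- The periodic sequence (α₁ ⋯ α_{n-1} 0)^∞. -/
def cutZero (α : Seq) (n : ℕ) : Seq :=
  fun i => if i % n = n - 1 then false else α (i % n)

/-- The periodic sequence (β₁ ⋯ β_{n-1} 1)^∞. -/
def cutOne (β : Seq) (n : ℕ) : Seq :=
  fun i => if i % n = n - 1 then true else β (i % n)

open Classical in
/-- The map ς : Σ₂¹ → Σ₂¹. -/
noncomputable def varsigma (α : Seq) : Seq :=
  if α ∈ ParryP then α else cutZero α (nAlpha α)

/-- The map ς' : Σ₂⁰ → Σ₂⁰, ς'(β) = mirror of ς(β̄). -/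
noncomputable def varsigma' (β : Seq) : Seq := mirror (varsigma (mirror β))

/-- M_α(β) = min{m ≥ 1 : σ^m β ≻ α}. -/
noncomputable def Msub (α β : Seq) : ℕ := sInf {m | 1 ≤ m ∧ lexLt α (shift^[m] β)}

/-- N_β(α) = min{n ≥ 1 : σⁿ α ≺ β}. -/
noncomputable def Nsub (α β : Seq) : ℕ := sInf {n | 1 ≤ n ∧ lexLt (shift^[n] α) β}

/-- ι(α) = (α₁ ⋯ α_{N_β(α)-1} 0)^∞. -/
noncomputable def iotaA (α β : Seq) : Seq := cutZero α (Nsub α β)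

/-- ι(β) = (β₁ ⋯ β_{M_α(β)-1} 1)^∞. -/
noncomputable def iotaB (α β : Seq) : Seq := cutOne β (Msub α β)

/-- ξ_α(β) = (β₁ ⋯ β_{M-1} 1)^∞ with M = M_α(β). -/
noncomputable def xiA (α β : Seq) : Seq := cutOne β (Msub α β)

/-- ξ'_β(α) = (α₁ ⋯ α_{N-1} 0)^∞ with N = N_β(α). -/
noncomputable def xiB (α β : Seq) : Seq := cutZero α (Nsub α β)

/-- A two sided extremal pair. -/
def twoSidedExtremal (α β : Seq) : Prop :=
  (∃ n, 1 ≤ n ∧ lexLt α (shift^[n] β)) ∧ (∃ m, 1 ≤ m ∧ lexLt (shift^[m] α) β)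

/-- A right extremal pair. -/
def rightExtremal (α β : Seq) : Prop :=
  (∀ m, 1 ≤ m → lexLt β (shift^[m] α)) ∧ (∃ n, 1 ≤ n ∧ lexLt α (shift^[n] β))

/-- A left extremal pair. -/
def leftExtremal (α β : Seq) : Prop :=
  (∀ n, 1 ≤ n → lexLt (shift^[n] β) α) ∧ (∃ m, 1 ≤ m ∧ lexLt (shift^[m] α) β)

/-- Dyadic rationals. -/
def IsDyadic (t : ℝ) : Prop := ∃ (z : ℤ) (n : ℕ), t = (z : ℝ) / 2 ^ n

/-- α₁ ⋯ α_n 1^∞. -/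
def onesAfter (α : Seq) (n : ℕ) : Seq := fun i => if i < n then α i else true

end DoublingHole

namespace DoublingHole

theorem lexLt_iff_toLex_lt {x y : Seq} : lexLt x y ↔ toLex x < toLex y := Iff.rfl

theorem lexLe_iff_toLex_le {x y : Seq} : lexLe x y ↔ toLex x ≤ toLex y := by
  rw [le_iff_lt_or_eq, toLex_inj]
  rfl

theorem lexLe_iff_not_lexLt {x y : Seq} : lexLe x y ↔ ¬ lexLt y x := by
  rw [lexLe_iff_toLex_le, lexLt_iff_toLex_lt]
  exact not_lt.symm

theorem lexLe.trans {x y z : Seq} (hxy : lexLe x y) (hyz : lexLe y z) : lexLe x z := by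
  rw [lexLe_iff_toLex_le] at *
  exact hxy.trans hyz

theorem shift_iterate_apply (x : Seq) (n i : ℕ) : shift^[n] x i = x (n + i) := by
  induction n generalizing i with
  | zero => simp
  | succ n ih =>
    rw [Function.iterate_succ_apply', shift, ih]
    congr 1
    omega

theorem lexLt_of_lexLt_shift {x y : Seq} (h0 : x 0 = y 0) (h : lexLt (shift x) (shift y)) :
    lexLt x y := by
  obtain ⟨k, hk, hlt⟩ := h
  refine ⟨k + 1, fun i hi => ?_, hlt⟩
  cases i with
  | zero => exact h0
  | succ i => exact hk i (by omega)

theorem lexLe_shift_of_head_eq_true {α : Seq} (h0 : α 0 = true) : lexLe (shift α) α := by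
  rw [lexLe_iff_not_lexLt]
  rintro ⟨k, hk, hlt⟩
  have hα : ∀ i ≤ k, α i = true := by
    intro i
    induction i with
    | zero => exact fun _ => h0
    | succ i ih => exact fun hi => (hk i hi).symm.trans (ih (by omega))
  rw [hα k le_rfl] at hlt
  exact absurd hlt (not_lt.2 le_top)

theorem nAlpha_mem {α : Seq} (h0 : α 0 = true) (hα : α ∉ ParryP) :
    1 ≤ nAlpha α ∧ lexLt α (shift^[nAlpha α] α) := by
  apply Nat.sInf_mem (s := {n | 1 ≤ n ∧ lexLt α (shift^[n] α)})
  by_contra hne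
  refine hα ⟨h0, fun n hn => lexLe_iff_not_lexLt.2 fun hlt => hne ⟨n, hn, hlt⟩⟩

theorem apply_nAlpha_sub_one {α : Seq} (h0 : α 0 = true) (hα : α ∉ ParryP) :
    α (nAlpha α - 1) = false := by
  obtain ⟨hn, hlt⟩ := nAlpha_mem h0 hα
  by_contra htrue
  rw [Bool.not_eq_false] at htrue
  have hle : lexLe (shift^[nAlpha α - 1] α) α := by
    rw [lexLe_iff_not_lexLt]
    intro hlt'
    by_cases hm : 1 ≤ nAlpha α - 1
    · have : nAlpha α ≤ nAlpha α - 1 := Nat.sInf_le ⟨hm, hlt'⟩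
      omega
    · have hm0 : nAlpha α - 1 = 0 := by omega
      rw [hm0] at hlt'
      exact lt_irrefl _ (lexLt_iff_toLex_lt.1 hlt')
  have hshift : shift^[nAlpha α] α = shift (shift^[nAlpha α - 1] α) := by
    rw [← Function.iterate_succ_apply' shift, Nat.succ_eq_add_one, Nat.sub_add_cancel hn]
  have hle' : lexLe (shift^[nAlpha α] α) (shift α) := by
    rw [hshift, lexLe_iff_not_lexLt]
    intro h
    refine lexLe_iff_not_lexLt.1 hle (lexLt_of_lexLt_shift ?_ h)
    rw [shift_iterate_apply, add_zero, h0, htrue]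
  exact lexLe_iff_not_lexLt.1 (hle'.trans (lexLe_shift_of_head_eq_true h0)) hlt

theorem cutZero_apply_of_lt {α : Seq} {n : ℕ} (hlast : α (n - 1) = false) {i : ℕ} (hi : i < n) :
    cutZero α n i = α i := by
  unfold cutZero
  rw [Nat.mod_eq_of_lt hi]
  split_ifs with h
  · rw [h, hlast]
  · rfl

theorem cutZero_add (α : Seq) (n i : ℕ) : cutZero α n (n + i) = cutZero α n i := by
  simp [cutZero]

theorem cutZero_lexLe {α : Seq} {n : ℕ} (hn : 1 ≤ n) (hlast : α (n - 1) = false)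
    (hlt : lexLt α (shift^[n] α)) : lexLe (cutZero α n) α := by
  rw [lexLe_iff_not_lexLt]
  rintro ⟨k, hk, hk'⟩
  by_cases hkn : k < n
  · rw [cutZero_apply_of_lt hlast hkn] at hk'
    exact lt_irrefl _ hk'
  · obtain ⟨j, rfl⟩ := Nat.exists_eq_add_of_le (not_lt.1 hkn)
    refine lt_asymm (lexLt_iff_toLex_lt.1 hlt)
      (lexLt_iff_toLex_lt.1 ⟨j, fun i hi => ?_, ?_⟩)
    · rw [shift_iterate_apply, hk (n + i) (by omega), cutZero_add, hk i (by omega)]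
    · rwa [shift_iterate_apply, hk j (by omega), ← cutZero_add]

theorem lexLe_cutZero {α : Seq} {n : ℕ} (hn : 1 ≤ n) (hlast : α (n - 1) = false) {x : Seq}
    (hx : ∀ k, lexLe (shift^[k] x) α) (k : ℕ) : lexLe (shift^[k] x) (cutZero α n) := by
  rw [lexLe_iff_not_lexLt]
  rintro ⟨j, hj, hlt⟩
  induction j using Nat.strong_induction_on generalizing k with
  | _ j ih =>
    by_cases hjn : j < n
    · refine lexLe_iff_not_lexLt.1 (hx k) ⟨j, fun i hi => ?_, ?_⟩
      · rw [← hj i hi, cutZero_apply_of_lt hlast (hi.trans hjn)]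
      · rwa [← cutZero_apply_of_lt hlast hjn]
    · obtain ⟨m, rfl⟩ := Nat.exists_eq_add_of_le (not_lt.1 hjn)
      refine ih m (by omega) (k + n) (fun i hi => ?_) ?_
      · rw [← cutZero_add, hj (n + i) (by omega), shift_iterate_apply, shift_iterate_apply,
          add_assoc]
      · rwa [shift_iterate_apply, add_assoc, ← shift_iterate_apply x k, ← cutZero_add α n m]

theorem forall_shift_lexLe_varsigma_iff {α : Seq} (h0 : α 0 = true) (x : Seq) :
    (∀ k, lexLe (shift^[k] x) (varsigma α)) ↔ ∀ k, lexLe (shift^[k] x) α := by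
  by_cases hα : α ∈ ParryP
  · rw [varsigma, if_pos hα]
  · rw [varsigma, if_neg hα]
    obtain ⟨hn, hlt⟩ := nAlpha_mem h0 hα
    have hlast := apply_nAlpha_sub_one h0 hα
    exact ⟨fun h k => (h k).trans (cutZero_lexLe hn hlast hlt), lexLe_cutZero hn hlast⟩

theorem mirror_mirror (x : Seq) : mirror (mirror x) = x := by
  funext i
  simp [mirror]

theorem lexLt_mirror_iff {x y : Seq} : lexLt (mirror x) (mirror y) ↔ lexLt y x := by
  have hlt : ∀ a b : Bool, ((!a) < (!b)) ↔ b < a := by decide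
  simp only [lexLt, mirror, Bool.not_inj_iff, hlt, eq_comm]

theorem lexLe_mirror_iff {x y : Seq} : lexLe (mirror x) (mirror y) ↔ lexLe y x := by
  rw [lexLe_iff_not_lexLt, lexLt_mirror_iff, lexLe_iff_not_lexLt]

theorem shift_iterate_mirror (x : Seq) (k : ℕ) :
    shift^[k] (mirror x) = mirror (shift^[k] x) := by
  funext i
  simp only [mirror, shift_iterate_apply]

theorem forall_varsigma'_lexLe_shift_iff {β : Seq} (h0 : β 0 = false) (x : Seq) :
    (∀ k, lexLe (varsigma' β) (shift^[k] x)) ↔ ∀ k, lexLe β (shift^[k] x) := by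
  have h := forall_shift_lexLe_varsigma_iff (α := mirror β) (by simp [mirror, h0]) (mirror x)
  simp only [shift_iterate_mirror, lexLe_mirror_iff] at h
  rw [← h]
  refine forall_congr' fun k => ?_
  rw [varsigma', ← lexLe_mirror_iff, mirror_mirror]

/-- for extremal (α,β) ∈ (Σ₂¹ ∖ P) × (Σ₂⁰ ∖ P̄) with σⁿβ ≺ α and
σⁿα ≻ β for all n ≥ 1, Σ_{(α,β)} = Σ_{(ς(α), ς'(β))}. -/
theorem statement9 (α β : Seq) (hα1 : α 0 = true) (hβ0 : β 0 = false)
    (hαP : α ∉ ParryP) (hβP : β ∉ barP)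
    (h1 : ∀ n, 1 ≤ n → lexLt (shift^[n] β) α)
    (h2 : ∀ n, 1 ≤ n → lexLt β (shift^[n] α)) :
    lexSubshift α β = lexSubshift (varsigma α) (varsigma' β) := by
  ext x
  simp only [lexSubshift, Set.mem_ofPred_eq, forall_and]
  rw [forall_shift_lexLe_varsigma_iff hα1, forall_varsigma'_lexLe_shift_iff hβ0]

end DoublingHole
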